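/- Let G be an undirected multigraph on V, f a maximum integral (s,t)-flow, and 𝒜 the set of anchor edges for f. If u, v ∈ V are vertices such that no (s,t)-mincut of the graph G∖𝒜 separates u and v, then every (s,t)-cut of G that separates u and v has capacity at least λ + 2. -/

import Mathlib

open Finset

section Defs

variable {V : Type*} [Fintype V] [DecidableEq V]

/-- Capacity of an `(s,t)`-cut `C` (sum of multiplicities of edges leaving `C`). -/
def capN (w : V → V → ℕ) (C : Finset V) : ℕ := ∑ u ∈ C, ∑ v ∈ Cᶜ, w u v

/-- A cut `C` separates `a` and `b` if exactly one of them lies in `C`. -/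
def Separates (C : Finset V) (a b : V) : Prop :=
  (a ∈ C ∧ b ∉ C) ∨ (b ∈ C ∧ a ∉ C)

/-- Flow leaving the cut `C`. -/
def flowOut (f : V → V → ℕ) (C : Finset V) : ℕ := ∑ u ∈ C, ∑ v ∈ Cᶜ, f u v

/-- Flow entering the cut `C`. -/
def flowIn (f : V → V → ℕ) (C : Finset V) : ℕ := ∑ u ∈ C, ∑ v ∈ Cᶜ, f v u

/-- Number of zero-flow edges across the cut `C`. -/
def zeroFlowCount (w f : V → V → ℕ) (C : Finset V) : ℕ :=
  ∑ u ∈ C, ∑ v ∈ Cᶜ, (w u v - f u v - f v u)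

/-- `{a, b}` is an anchor edge for the maximum flow `f`: some edge between `a` and `b`
carries no flow, and some `(λ+1)` `(s,t)`-cut separates `a` and `b`. -/
def IsAnchor (s t : V) (w f : V → V → ℕ) (lam : ℕ) (a b : V) : Prop :=
  a ≠ b ∧ 1 ≤ w a b - f a b - f b a ∧
    ∃ C : Finset V, s ∈ C ∧ t ∉ C ∧ capN w C = lam + 1 ∧ Separates C a b

end Defs

open Classical in
/-- The graph `G∖𝒜`: one zero-flow edge removed for each anchor edge. -/
noncomputable def wMinusAnchors {V : Type*} [Fintype V] [DecidableEq V]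
    (s t : V) (w f : V → V → ℕ) (lam : ℕ) : V → V → ℕ :=
  fun u v => if IsAnchor s t w f lam u v then w u v - 1 else w u v

section Flow

variable {V : Type*} [Fintype V] [DecidableEq V]

/-- The net flow across any `(s,t)`-cut is the value of the flow. -/
lemma flowOut_eq_add_flowIn {s t : V} {f : V → V → ℕ}
    (hcons : ∀ x, x ≠ s → x ≠ t → ∑ v, f x v = ∑ v, f v x) {lam : ℕ}
    (hval : ∑ v, f s v = lam + ∑ v, f v s) {C : Finset V} (hs : s ∈ C) (ht : t ∉ C) :
    flowOut f C = lam + flowIn f C := by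
  have total : ∑ x ∈ C, ∑ v, f x v = lam + ∑ x ∈ C, ∑ v, f v x := by
    rw [← Finset.add_sum_erase C _ hs, ← Finset.add_sum_erase C (fun x => ∑ v, f v x) hs, hval,
      Finset.sum_congr rfl fun x hx => hcons x (Finset.ne_of_mem_erase hx)
        (ne_of_mem_of_not_mem (Finset.mem_of_mem_erase hx) ht)]
    ring
  have hout : ∑ x ∈ C, ∑ v, f x v = ∑ x ∈ C, ∑ v ∈ C, f x v + flowOut f C := by
    rw [flowOut, ← Finset.sum_add_distrib]
    exact Finset.sum_congr rfl fun x _ => (Finset.sum_add_sum_compl C _).symm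
  have hin : ∑ x ∈ C, ∑ v, f v x = ∑ x ∈ C, ∑ v ∈ C, f v x + flowIn f C := by
    rw [flowIn, ← Finset.sum_add_distrib]
    exact Finset.sum_congr rfl fun x _ => (Finset.sum_add_sum_compl C _).symm
  have hinner : ∑ x ∈ C, ∑ v ∈ C, f x v = ∑ x ∈ C, ∑ v ∈ C, f v x := Finset.sum_comm
  omega

lemma capN_eq_flowOut_add_flowIn_add_zeroFlowCount {w f : V → V → ℕ}
    (hflow : ∀ u v, f u v + f v u ≤ w u v) (C : Finset V) :
    capN w C = flowOut f C + flowIn f C + zeroFlowCount w f C := by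
  simp only [capN, flowOut, flowIn, zeroFlowCount, ← Finset.sum_add_distrib]
  refine Finset.sum_congr rfl fun x _ => Finset.sum_congr rfl fun y _ => ?_
  have := hflow x y
  omega

lemma wMinusAnchors_le (s t : V) (w f : V → V → ℕ) (lam : ℕ) (a b : V) :
    wMinusAnchors s t w f lam a b ≤ w a b := by
  unfold wMinusAnchors
  split_ifs <;> omega

/-- Removing the anchor edges leaves the flow feasible. -/
lemma add_le_wMinusAnchors {w f : V → V → ℕ} (hflow : ∀ u v, f u v + f v u ≤ w u v)
    (s t : V) (lam : ℕ) (a b : V) :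
    f a b + f b a ≤ wMinusAnchors s t w f lam a b := by
  unfold wMinusAnchors
  have := hflow a b
  split_ifs with h
  · have := h.2.1
    omega
  · exact this

lemma le_capN_wMinusAnchors {s t : V} {w f : V → V → ℕ}
    (hflow : ∀ u v, f u v + f v u ≤ w u v)
    (hcons : ∀ x, x ≠ s → x ≠ t → ∑ v, f x v = ∑ v, f v x) {lam : ℕ}
    (hval : ∑ v, f s v = lam + ∑ v, f v s) {C : Finset V} (hs : s ∈ C) (ht : t ∉ C) :
    lam ≤ capN (wMinusAnchors s t w f lam) C := by
  rw [capN_eq_flowOut_add_flowIn_add_zeroFlowCount (add_le_wMinusAnchors hflow s t lam),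
    flowOut_eq_add_flowIn hcons hval hs ht]
  omega

/-- An `(s,t)`-cut of capacity at most `λ + 1` becomes a mincut once the anchor edges are
removed. -/
lemma capN_wMinusAnchors_le {s t : V} {w f : V → V → ℕ}
    (hflow : ∀ u v, f u v + f v u ≤ w u v)
    (hcons : ∀ x, x ≠ s → x ≠ t → ∑ v, f x v = ∑ v, f v x) {lam : ℕ}
    (hval : ∑ v, f s v = lam + ∑ v, f v s) {C : Finset V} (hs : s ∈ C) (ht : t ∉ C)
    (hC : capN w C ≤ lam + 1) :
    capN (wMinusAnchors s t w f lam) C ≤ lam := by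
  have hle (x : V) : ∑ y ∈ Cᶜ, wMinusAnchors s t w f lam x y ≤ ∑ y ∈ Cᶜ, w x y :=
    Finset.sum_le_sum fun y _ => wMinusAnchors_le s t w f lam x y
  rcases Nat.le_succ_iff.mp hC with hC | hC
  · exact (Finset.sum_le_sum fun x _ => hle x).trans hC
  · have hzero : zeroFlowCount w f C ≠ 0 := by
      have h₁ := capN_eq_flowOut_add_flowIn_add_zeroFlowCount hflow C
      have h₂ := flowOut_eq_add_flowIn hcons hval hs ht
      omega
    obtain ⟨a, ha, ha'⟩ := Finset.exists_ne_zero_of_sum_ne_zero hzero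
    obtain ⟨b, hb, hab⟩ := Finset.exists_ne_zero_of_sum_ne_zero ha'
    have hbC : b ∉ C := Finset.mem_compl.mp hb
    have anchor : IsAnchor s t w f lam a b :=
      ⟨ne_of_mem_of_not_mem ha hbC, Nat.one_le_iff_ne_zero.mpr hab,
        C, hs, ht, hC, Or.inl ⟨ha, hbC⟩⟩
    have hlt : wMinusAnchors s t w f lam a b < w a b := by
      rw [wMinusAnchors, if_pos anchor]
      omega
    have : capN (wMinusAnchors s t w f lam) C < capN w C :=
      Finset.sum_lt_sum (fun x _ => hle x)
        ⟨a, ha, Finset.sum_lt_sum (fun y _ => wMinusAnchors_le s t w f lam a y) ⟨b, hb, hlt⟩⟩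
    omega

end Flow

/-- If no `(s,t)`-mincut of `G∖𝒜` separates `u` and `v`, then every `(s,t)`-cut of `G`
separating `u` and `v` has capacity at least `λ + 2`. -/
theorem sep_cut_ge_lam_add_two_of_same_node
    {V : Type*} [Fintype V] [DecidableEq V] (s t : V) (hst : s ≠ t)
    (w f : V → V → ℕ)
    (hsym : ∀ u v, w u v = w v u) (hwdiag : ∀ v, w v v = 0)
    (hflow : ∀ u v, f u v + f v u ≤ w u v)
    (hcons : ∀ x, x ≠ s → x ≠ t → ∑ v, f x v = ∑ v, f v x)
    (lam : ℕ)
    (hlam : IsLeast {x : ℕ | ∃ C : Finset V, s ∈ C ∧ t ∉ C ∧ capN w C = x} lam)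
    (hval : ∑ v, f s v = lam + ∑ v, f v s)
    (u v : V) (lam' : ℕ)
    (hlam' : IsLeast {x : ℕ | ∃ C : Finset V, s ∈ C ∧ t ∉ C ∧
      capN (wMinusAnchors s t w f lam) C = x} lam')
    (hnosep : ∀ C : Finset V, s ∈ C → t ∉ C →
      capN (wMinusAnchors s t w f lam) C = lam' → ¬ Separates C u v) :
    ∀ C : Finset V, s ∈ C → t ∉ C → Separates C u v → lam + 2 ≤ capN w C := by
  intro C hs ht hsep
  by_contra! hlt
  have hC := capN_wMinusAnchors_le hflow hcons hval hs ht (by omega : capN w C ≤ lam + 1)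
  obtain ⟨D, hsD, htD, hD⟩ := hlam'.1
  have hlamD := le_capN_wMinusAnchors hflow hcons hval hsD htD
  have hle : lam' ≤ capN (wMinusAnchors s t w f lam) C := hlam'.2 ⟨C, hs, ht, rfl⟩
  exact hnosep C hs ht (by omega) hsep
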